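/- arXiv:0802.1888 — 11 statements merged into one kernel-verified Lean document; each statement's English description precedes it below -/
import Mathlib

section
/- Let n and N be positive integers, b : Fin n → Fin N a monotone (nondecreasing) block-labeling, ρ ≥ 0 a real number, and H an n×n complex matrix that is block lower triangular with respect to b, i.e. H i j = 0 whenever b i < b j. Let H_d be the block-diagonal part of H, defined by (H_d) i j = H i j when b i = b j and (H_d) i j = 0 otherwise. Then I + ρ·H·Hᴴ and I + ρ·H_d·H_dᴴ are Hermitian positive definite, their determinants are positive real numbers, and det(I + ρ·H·Hᴴ) ≥ det(I + ρ·H_d·H_dᴴ). -/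
open Matrix ComplexOrder

/-- The matrix `I + ρ·A·Aᴴ` associated to a channel matrix `A` at SNR `ρ`. -/
noncomputable def snrMat (ρ : ℝ) {n : ℕ} (A : Matrix (Fin n) (Fin n) ℂ) :
    Matrix (Fin n) (Fin n) ℂ :=
  1 + (ρ : ℂ) • (A * Aᴴ)

theorem aux_det_add {n : Type*} [Fintype n] [DecidableEq n] {X Y : Matrix n n ℂ}
    (hX : X.PosDef) (hY : Y.PosSemidef) : X.det ≤ (X + Y).det := by
  obtain ⟨m, A, rfl⟩ := Matrix.posSemidef_iff_eq_sum_vecMulVec.mp hY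
  clear hY
  have key : ∀ s : Finset (Fin m), (X + ∑ i ∈ s, vecMulVec (A i) (star (A i))).PosDef ∧
      X.det ≤ (X + ∑ i ∈ s, vecMulVec (A i) (star (A i))).det := by
    intro s
    induction s using Finset.induction_on with
    | empty => simpa using hX
    | insert a s ha ih =>
      rw [Finset.sum_insert ha, add_comm (vecMulVec _ _), ← add_assoc]
      generalize X + ∑ i ∈ s, vecMulVec (A i) (star (A i)) = Z at ih
      obtain ⟨hZ, hd⟩ := ih
      refine ⟨hZ.add_posSemidef (posSemidef_vecMulVec_self_star (A a)), hd.trans ?_⟩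
      have h2 : (Z + vecMulVec (A a) (star (A a))).det
          = Z.det * (1 + star (A a) ⬝ᵥ Z⁻¹ *ᵥ (A a)) := by
        rw [vecMulVec_eq Unit, det_add_replicateCol_mul_replicateRow hZ.det_pos.ne'.isUnit]
        congr 1
        rw [det_unique]
        simp [← replicateRow_vecMul, Matrix.mul_apply, dotProduct, vecMul, mulVec]
      rw [h2]
      have h3 : 0 ≤ star (A a) ⬝ᵥ Z⁻¹ *ᵥ (A a) :=
        hZ.inv.posSemidef.dotProduct_mulVec_nonneg (A a)
      exact le_mul_of_one_le_right hZ.det_pos.le (le_add_of_nonneg_right h3)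
  exact (key Finset.univ).2

theorem aux_posDef {m : Type*} [Fintype m] [DecidableEq m] {k : Type*} [Fintype k] {ρ : ℝ}
    (hρ : 0 ≤ ρ) (A : Matrix m k ℂ) : (1 + (ρ : ℂ) • (A * Aᴴ)).PosDef := by
  refine PosDef.one.add_posSemidef ((posSemidef_self_mul_conjTranspose A).smul ?_)
  exact_mod_cast hρ

theorem aux_blocks {m n : Type*} [Fintype m] [DecidableEq m] [Fintype n] [DecidableEq n]
    {ρ : ℝ} (hρ : 0 ≤ ρ) (A : Matrix m m ℂ) (C : Matrix n m ℂ) (D : Matrix n n ℂ) :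
    (1 + (ρ : ℂ) • (fromBlocks A 0 0 D * (fromBlocks A 0 0 D)ᴴ)).det ≤
    (1 + (ρ : ℂ) • (fromBlocks A 0 C D * (fromBlocks A 0 C D)ᴴ)).det := by
  have hρ' : (0 : ℂ) ≤ (ρ : ℂ) := by exact_mod_cast hρ
  have hP := aux_posDef hρ A
  have hQ := aux_posDef hρ D
  have e1 : 1 + (ρ : ℂ) • (fromBlocks A 0 0 D * (fromBlocks A 0 0 D)ᴴ)
      = fromBlocks (1 + (ρ : ℂ) • (A * Aᴴ)) 0 0 (1 + (ρ : ℂ) • (D * Dᴴ)) := by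
    simp [fromBlocks_conjTranspose, fromBlocks_multiply, fromBlocks_smul, ← fromBlocks_one,
      fromBlocks_add]
  have e2 : 1 + (ρ : ℂ) • (fromBlocks A 0 C D * (fromBlocks A 0 C D)ᴴ)
      = fromBlocks (1 + (ρ : ℂ) • (A * Aᴴ)) ((ρ : ℂ) • (A * Cᴴ)) ((ρ : ℂ) • (A * Cᴴ))ᴴ
        ((1 + (ρ : ℂ) • (D * Dᴴ)) + (ρ : ℂ) • (C * Cᴴ)) := by
    simp [fromBlocks_conjTranspose, fromBlocks_multiply, fromBlocks_smul, ← fromBlocks_one,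
      fromBlocks_add]
    abel
  have e3 : (fromBlocks (1 + (ρ : ℂ) • (A * Aᴴ)) ((ρ : ℂ) • (A * Cᴴ)) ((ρ : ℂ) • (A * Cᴴ))ᴴ
        ((ρ : ℂ) • (C * Cᴴ))).PosSemidef := by
    have h := ((posSemidef_self_mul_conjTranspose (fromBlocks A 0 C (0 : Matrix n n ℂ))).smul
      hρ').add (posSemidef_self_mul_conjTranspose
        (fromBlocks (1 : Matrix m m ℂ) 0 0 (0 : Matrix n n ℂ)))
    convert h using 1
    simp [fromBlocks_conjTranspose, fromBlocks_multiply, fromBlocks_smul, 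
      fromBlocks_add, add_comm]
  haveI : Invertible (1 + (ρ : ℂ) • (A * Aᴴ)) := hP.isUnit.invertible
  rw [PosDef.fromBlocks₁₁ _ _ hP] at e3
  rw [e1, e2, det_fromBlocks_zero₁₂, det_fromBlocks₁₁, invOf_eq_nonsing_inv, add_sub_assoc]
  exact mul_le_mul_of_nonneg_left (aux_det_add hQ e3) hP.det_pos.le

theorem aux_step {n : Type*} [Fintype n] [DecidableEq n] (p : n → Prop) [DecidablePred p]
    {ρ : ℝ} (hρ : 0 ≤ ρ) (H H' : Matrix n n ℂ)
    (h1 : ∀ i j, (p i ↔ p j) → H' i j = H i j)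
    (h2 : ∀ i j, p i → ¬ p j → H i j = 0)
    (h3 : ∀ i j, p i → ¬ p j → H' i j = 0)
    (h4 : ∀ i j, ¬ p i → p j → H' i j = 0) :
    (1 + (ρ : ℂ) • (H' * H'ᴴ)).det ≤ (1 + (ρ : ℂ) • (H * Hᴴ)).det := by
  let e := Equiv.sumCompl p
  have tr : ∀ K : Matrix n n ℂ, (1 + (ρ : ℂ) • (K * Kᴴ)).det =
      (1 + (ρ : ℂ) • (K.submatrix e e * (K.submatrix e e)ᴴ)).det := by
    intro K
    rw [← det_submatrix_equiv_self e]
    congr 1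
    rw [conjTranspose_submatrix, submatrix_mul_equiv, ← submatrix_one_equiv e]
    rfl
  have a1 : H.submatrix e e = fromBlocks (H.submatrix e e).toBlocks₁₁ 0
      (H.submatrix e e).toBlocks₂₁ (H.submatrix e e).toBlocks₂₂ := by
    ext (i | i) (j | j)
    · rfl
    · exact h2 _ _ i.2 j.2
    · rfl
    · rfl
  have a2 : H'.submatrix e e = fromBlocks (H.submatrix e e).toBlocks₁₁ 0
      0 (H.submatrix e e).toBlocks₂₂ := by
    ext (i | i) (j | j)
    · exact h1 _ _ (iff_of_true i.2 j.2)
    · exact h3 _ _ i.2 j.2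
    · exact h4 _ _ i.2 j.2
    · exact h1 _ _ (iff_of_false i.2 j.2)
  rw [tr H, tr H', a1, a2]
  exact aux_blocks hρ _ _ _

theorem aux_main {n N : ℕ} (b : Fin n → Fin N) {ρ : ℝ} (hρ : 0 ≤ ρ)
    (H : Matrix (Fin n) (Fin n) ℂ) (hH : ∀ i j, b i < b j → H i j = 0) (k : ℕ) :
    (snrMat ρ (fun i j => if b i = b j then H i j else 0)).det ≤ (snrMat ρ
      (fun i j => if b i = b j ∨ (b i : ℕ) < k then H i j else 0)).det := by
  induction k with
  | zero => simp
  | succ k ih =>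
    refine le_trans ih (aux_step (fun i => (b i : ℕ) < k) hρ _ _ ?_ ?_ ?_ ?_)
    all_goals
      intro i j
      have := hH i j
      simp only [Fin.lt_def, Fin.ext_iff] at *
      grind

/-- For a block lower triangular matrix `H` (with respect to a monotone block
labeling `b`), with block-diagonal part `H_d`, the matrices `I + ρ·H·Hᴴ` and
`I + ρ·H_d·H_dᴴ` are Hermitian positive definite, their determinants are
positive reals, and `det(I + ρ·H·Hᴴ) ≥ det(I + ρ·H_d·H_dᴴ)`. -/
theorem stmt_0 {n N : ℕ} (hn : 0 < n) (hN : 0 < N)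
    (b : Fin n → Fin N) (hb : Monotone b)
    (ρ : ℝ) (hρ : 0 ≤ ρ)
    (H Hd : Matrix (Fin n) (Fin n) ℂ)
    (hH : ∀ i j, b i < b j → H i j = 0)
    (hHd : ∀ i j, Hd i j = if b i = b j then H i j else 0) :
    (snrMat ρ H).PosDef ∧ (snrMat ρ Hd).PosDef ∧
    ((snrMat ρ H).det).im = 0 ∧ 0 < ((snrMat ρ H).det).re ∧
    ((snrMat ρ Hd).det).im = 0 ∧ 0 < ((snrMat ρ Hd).det).re ∧
    ((snrMat ρ Hd).det).re ≤ ((snrMat ρ H).det).re := by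
  have p1 : (snrMat ρ H).PosDef := aux_posDef hρ H
  have p2 : (snrMat ρ Hd).PosDef := aux_posDef hρ Hd
  have d1 := Complex.lt_def.mp p1.det_pos
  have d2 := Complex.lt_def.mp p2.det_pos
  have hm := aux_main b hρ H hH N
  have q1 : (fun i j => if b i = b j then H i j else 0 : Matrix (Fin n) (Fin n) ℂ) = Hd := by
    ext i j
    exact (hHd i j).symm
  have q2 : (fun i j => if b i = b j ∨ (b i : ℕ) < N then H i j else 0 :
      Matrix (Fin n) (Fin n) ℂ) = H := by
    ext i j
    simp
  rw [q1, q2] at hm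
  exact ⟨p1, p2, d1.2.symm, d1.1, d2.2.symm, d2.1, (Complex.le_def.mp hm).1⟩
end

section
/- Let n and N be positive integers, b : Fin n → Fin N a monotone (nondecreasing) block-labeling, ρ ≥ 0 a real number, and ℓ ≥ 1 a natural number. Let H be an n×n complex matrix such that H i j = 0 whenever b i < b j and also H i j = 0 whenever (b i : ℕ) − (b j : ℕ) > ℓ (so the ℓ-th sub-diagonal is the last possibly nonzero block sub-diagonal of H). Let H_ℓ be the matrix defined by (H_ℓ) i j = H i j when (b i : ℕ) = (b j : ℕ) + ℓ and (H_ℓ) i j = 0 otherwise. Then det(I + ρ·H·Hᴴ) ≥ det(I + ρ·H_ℓ·H_ℓᴴ), both determinants being positive real numbers. -/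
open Matrix ComplexOrder

theorem one_le_det_one_add {n : ℕ} {T : Matrix (Fin n) (Fin n) ℂ} (hT : T.PosSemidef) :
    1 ≤ (1 + T).det := by
  have hs := hT.isHermitian.spectral_theorem
  set U := hT.isHermitian.eigenvectorUnitary with hU
  rw [Unitary.conjStarAlgAut_apply] at hs
  have hUU : (U : Matrix (Fin n) (Fin n) ℂ) * star (U : Matrix (Fin n) (Fin n) ℂ) = 1 :=
    Unitary.coe_mul_star_self U
  have e : 1 + T = (U : Matrix (Fin n) (Fin n) ℂ) *
      diagonal (fun i => 1 + ((hT.isHermitian.eigenvalues i : ℝ) : ℂ)) *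
        star (U : Matrix (Fin n) (Fin n) ℂ) := by
    rw [← diagonal_add, Matrix.mul_add, Matrix.add_mul, diagonal_one, Matrix.mul_one, hUU]
    congr 1
  have hd := congrArg det hUU
  rw [det_mul, det_one] at hd
  rw [e, det_mul, det_mul, mul_right_comm, hd, one_mul, det_diagonal]
  have : (1 : ℝ) ≤ ∏ i, (1 + hT.isHermitian.eigenvalues i) := by
    apply Finset.one_le_prod
    intro i _
    have := hT.eigenvalues_nonneg i
    simpa using this
  exact_mod_cast this

open scoped MatrixOrder in
theorem det_le_of_add {n : ℕ} {Y S : Matrix (Fin n) (Fin n) ℂ} (hY : Y.PosDef)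
    (hS : S.PosSemidef) : Y.det ≤ (Y + S).det := by
  obtain ⟨R, hR⟩ : ∃ R : Matrix (Fin n) (Fin n) ℂ, Y = Rᴴ * R :=
    (CStarAlgebra.nonneg_iff_eq_star_mul_self (a := Y)).1 hY.posSemidef.nonneg
  have hYd := hY.det_pos
  have hRu : IsUnit R.det := by
    rw [isUnit_iff_ne_zero]
    intro h
    rw [hR, det_mul, h, mul_zero] at hYd
    exact lt_irrefl _ hYd
  have hT : ((R⁻¹)ᴴ * S * R⁻¹).PosSemidef := hS.conjTranspose_mul_mul_same _
  have h1 : R⁻¹ * R = 1 := nonsing_inv_mul _ hRu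
  have h2 : Rᴴ * (R⁻¹)ᴴ = 1 := by rw [← conjTranspose_mul, h1, conjTranspose_one]
  have e : Y + S = Rᴴ * (1 + (R⁻¹)ᴴ * S * R⁻¹) * R := by
    have : Rᴴ * ((R⁻¹)ᴴ * S * R⁻¹) * R = (Rᴴ * (R⁻¹)ᴴ) * S * (R⁻¹ * R) := by
      simp only [Matrix.mul_assoc]
    rw [Matrix.mul_add, Matrix.add_mul, this, h1, h2, Matrix.mul_one, Matrix.mul_one,
      Matrix.one_mul, ← hR]
  have e2 : (Y + S).det = Y.det * (1 + (R⁻¹)ᴴ * S * R⁻¹).det := by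
    rw [e, det_mul, det_mul, mul_right_comm, ← det_mul, ← hR]
  rw [e2]
  exact le_mul_of_one_le_right hYd.le (one_le_det_one_add hT)

theorem snr_posDef {n : ℕ} {ρ : ℝ} (hρ : 0 ≤ ρ) (A : Matrix (Fin n) (Fin n) ℂ) :
    (snrMat ρ A).PosDef := by
  apply PosDef.one.add_posSemidef
  exact (posSemidef_self_mul_conjTranspose A).smul (by exact_mod_cast hρ)

theorem det_cs {n : ℕ} {ρ : ℝ} (hρ : 0 ≤ ρ) (A B : Matrix (Fin n) (Fin n) ℂ)
    (hX : (1 + (ρ : ℂ) • (A * Bᴴ)).det = (snrMat ρ B).det) :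
    (snrMat ρ B).det ≤ (snrMat ρ A).det := by
  set X := 1 + (ρ : ℂ) • (A * Bᴴ) with hXd
  have hP := snr_posDef hρ A
  have hQ := snr_posDef hρ B
  have hPd := hP.det_pos
  have hQd := hQ.det_pos
  have hXu : IsUnit X := by
    rw [isUnit_iff_isUnit_det, hX]
    exact hQd.ne'.isUnit
  have hPu : IsUnit (snrMat ρ A) := hP.isUnit
  let _ := hPu.invertible
  have hblk : (fromBlocks (snrMat ρ A) X Xᴴ (snrMat ρ B)).PosSemidef := by
    have h1 := posSemidef_self_mul_conjTranspose
      (fromBlocks (1 : Matrix (Fin n) (Fin n) ℂ) 0 (1 : Matrix (Fin n) (Fin n) ℂ)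
        (0 : Matrix (Fin n) (Fin n) ℂ))
    have h2 := (posSemidef_self_mul_conjTranspose (fromBlocks A 0 B
        (0 : Matrix (Fin n) (Fin n) ℂ))).smul (show (0 : ℂ) ≤ (ρ : ℂ) by exact_mod_cast hρ)
    have h3 := h1.add h2
    convert h3 using 1
    simp [fromBlocks_conjTranspose, fromBlocks_multiply, fromBlocks_smul, fromBlocks_add, snrMat,
      hXd, conjTranspose_add, conjTranspose_smul, conjTranspose_mul]
  have hS := (PosDef.fromBlocks₁₁ X (snrMat ρ B) hP).1 hblk
  have hY : (Xᴴ * (snrMat ρ A)⁻¹ * X).PosDef :=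
    hP.inv.conjTranspose_mul_mul_same (mulVec_injective_of_isUnit hXu)
  have h := det_le_of_add hY hS
  rw [add_sub_cancel, det_mul, det_mul, det_conjTranspose, hX, det_nonsing_inv,
    Ring.inverse_eq_inv'] at h
  have hstar : star (snrMat ρ B).det = (snrMat ρ B).det := by
    rw [← det_conjTranspose, hQ.isHermitian.eq]
  rw [hstar] at h
  generalize (snrMat ρ B).det = d at *
  generalize (snrMat ρ A).det = p at *
  have h4 : d * (d * p⁻¹) ≤ d * 1 := by rw [mul_one]; convert h using 1; ring
  have h5 : d * p⁻¹ ≤ 1 := le_of_mul_le_mul_left h4 hQd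
  have h6 := mul_le_mul_of_nonneg_right h5 hPd.le
  rwa [mul_assoc, inv_mul_cancel₀ hPd.ne', mul_one, one_mul] at h6

/-- For a block lower triangular matrix `H` (with respect to a monotone block
labeling `b`) whose last possibly nonzero block sub-diagonal is the `ℓ`-th one,
with `ℓ`-th sub-diagonal part `H_ℓ`, one has
`det(I + ρ·H·Hᴴ) ≥ det(I + ρ·H_ℓ·H_ℓᴴ)`, both determinants being positive
reals. -/
theorem stmt_1 {n N : ℕ} (hn : 0 < n) (hN : 0 < N)
    (b : Fin n → Fin N) (hb : Monotone b)
    (ρ : ℝ) (hρ : 0 ≤ ρ) (ℓ : ℕ) (hℓ : 1 ≤ ℓ)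
    (H Hl : Matrix (Fin n) (Fin n) ℂ)
    (hH : ∀ i j, b i < b j → H i j = 0)
    (hHsub : ∀ i j, (b i : ℕ) - (b j : ℕ) > ℓ → H i j = 0)
    (hHl : ∀ i j, Hl i j = if (b i : ℕ) = (b j : ℕ) + ℓ then H i j else 0) :
    ((snrMat ρ H).det).im = 0 ∧ 0 < ((snrMat ρ H).det).re ∧
    ((snrMat ρ Hl).det).im = 0 ∧ 0 < ((snrMat ρ Hl).det).re ∧
    ((snrMat ρ Hl).det).re ≤ ((snrMat ρ H).det).re := by
  have h1 := Complex.pos_iff.1 (snr_posDef hρ H).det_pos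
  have h2 := Complex.pos_iff.1 (snr_posDef hρ Hl).det_pos
  have hent : ∀ i j, b j ≤ b i → (H * Hlᴴ) i j = (Hl * Hlᴴ) i j := by
    intro i j hij
    have hij' : (b j : ℕ) ≤ b i := hij
    simp only [mul_apply, conjTranspose_apply]
    refine Finset.sum_congr rfl fun k _ => ?_
    by_cases hk : (b j : ℕ) = b k + ℓ
    · congr 1
      rw [hHl i k]
      split_ifs with h
      · rfl
      · exact hHsub i k (by omega)
    · rw [hHl j k, if_neg hk, star_zero, mul_zero, mul_zero]
  have hzero : ∀ i j, b j < b i → (Hl * Hlᴴ) i j = 0 := by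
    intro i j hij
    have hij' : (b j : ℕ) < b i := hij
    simp only [mul_apply, conjTranspose_apply]
    refine Finset.sum_eq_zero fun k _ => ?_
    rw [hHl i k, hHl j k]
    split_ifs with h h'
    · omega
    all_goals simp
  have hne : ∀ i j, b j < b i → i ≠ j := by
    rintro i j h rfl
    exact lt_irrefl _ h
  have hdet : (1 + (ρ : ℂ) • (H * Hlᴴ)).det = (snrMat ρ Hl).det := by
    have t1 : BlockTriangular (1 + (ρ : ℂ) • (H * Hlᴴ)) b := by
      intro i j hij
      rw [Matrix.add_apply, Matrix.smul_apply, hent i j hij.le, hzero i j hij, one_apply_ne (hne i j hij)]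
      simp
    have t2 : BlockTriangular (snrMat ρ Hl) b := by
      intro i j hij
      rw [snrMat, Matrix.add_apply, Matrix.smul_apply, hzero i j hij, one_apply_ne (hne i j hij)]
      simp
    rw [t1.det_fintype, t2.det_fintype]
    refine Finset.prod_congr rfl fun k _ => ?_
    congr 1
    ext ⟨i, hi⟩ ⟨j, hj⟩
    simp only [toSquareBlock_def, of_apply, snrMat, Matrix.add_apply, Matrix.smul_apply]
    rw [hent i j (by rw [hi, hj])]
  have hle := Complex.le_def.1 (det_cs hρ H Hl hdet)
  exact ⟨h1.2.symm, h1.1, h2.2.symm, h2.1, hle.1⟩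
end

section
/- Let n and N be positive integers, b : Fin n → Fin N a monotone (nondecreasing) block-labeling, ρ ≥ 0 a real number, and H an n×n complex matrix that is block upper triangular with respect to b, i.e. H i j = 0 whenever b i > b j. Let H_d be its block-diagonal part ((H_d) i j = H i j when b i = b j, else 0), and, for a natural number ℓ ≥ 1 such that H i j = 0 whenever (b j : ℕ) − (b i : ℕ) > ℓ, let H_ℓ be its ℓ-th super-diagonal part ((H_ℓ) i j = H i j when (b j : ℕ) = (b i : ℕ) + ℓ, else 0). Then det(I + ρ·H·Hᴴ) ≥ det(I + ρ·H_d·H_dᴴ) and det(I + ρ·H·Hᴴ) ≥ det(I + ρ·H_ℓ·H_ℓᴴ), all three determinants being positive real numbers. -/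
open Matrix ComplexOrder

theorem aux_one_le_det {m : Type*} [Fintype m] [DecidableEq m] (S : Matrix m m ℂ)
    (hS : S.PosSemidef) : 1 ≤ (1 + S).det := by
  have h := congrArg (Polynomial.eval (-1 : ℂ)) hS.1.charpoly_eq
  rw [Matrix.eval_charpoly, Polynomial.eval_prod] at h
  have e : (1 + S) = -(Matrix.scalar m (-1 : ℂ) - S) := by
    ext i j
    by_cases hij : i = j <;> simp [Matrix.one_apply, hij, Matrix.diagonal_apply] <;> ring
  rw [e, Matrix.det_neg, h, ← Finset.card_univ, ← Finset.prod_const, ← Finset.prod_mul_distrib]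
  have e2 : ∀ i, (-1 : ℂ) * Polynomial.eval (-1) (Polynomial.X - Polynomial.C ((hS.1.eigenvalues i : ℝ) : ℂ))
      = ((1 + hS.1.eigenvalues i : ℝ) : ℂ) := by
    intro i
    simp
    ring
  have e3 : (1 : ℝ) ≤ ∏ i, (1 + hS.1.eigenvalues i) := by
    refine (Finset.prod_const_one (s := (Finset.univ : Finset m))).symm.trans_le ?_
    refine Finset.prod_le_prod (fun _ _ => zero_le_one) fun i _ => ?_
    have := hS.eigenvalues_nonneg i
    linarith
  have e4 : (1 : ℂ) ≤ ((∏ i, (1 + hS.1.eigenvalues i) : ℝ) : ℂ) := by exact_mod_cast e3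
  refine e4.trans_eq ?_
  rw [Complex.ofReal_prod]
  exact Finset.prod_congr rfl fun i _ => (e2 i).symm

theorem aux_gram {n : ℕ} {m : Type*} [Fintype m] [DecidableEq m] (W K : Matrix (Fin n) m ℂ)
    (hP : (K * Kᴴ).PosDef) (hM : (W * Kᴴ).det = (K * Kᴴ).det) :
    (K * Kᴴ).det ≤ (W * Wᴴ).det := by
  have hd := hP.det_pos
  set P := K * Kᴴ with hPdef
  set M := W * Kᴴ with hMdef
  have hMu : IsUnit M.det := by rw [hM]; exact hd.ne'.isUnit
  have hPu : IsUnit P.det := hd.ne'.isUnit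
  have hC : (W * Wᴴ - M * P⁻¹ * Mᴴ).PosSemidef := by
    haveI := Matrix.invertibleOfIsUnitDet P hPu
    rw [← Matrix.PosDef.fromBlocks₂₂ _ _ hP]
    have := Matrix.posSemidef_self_mul_conjTranspose (Matrix.fromRows W K)
    rw [Matrix.conjTranspose_fromRows_eq_fromCols_conjTranspose, Matrix.fromRows_mul_fromCols] at this
    simpa [hMdef, hPdef] using this
  set C := W * Wᴴ - M * P⁻¹ * Mᴴ with hCdef
  have hS := hC.mul_mul_conjTranspose_same M⁻¹
  set S := M⁻¹ * C * (M⁻¹)ᴴ with hSdef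
  have hMM : M * M⁻¹ = 1 := Matrix.mul_nonsing_inv _ hMu
  have hMM' : (M⁻¹)ᴴ * Mᴴ = 1 := by rw [← Matrix.conjTranspose_mul, hMM, Matrix.conjTranspose_one]
  have hCS : M * S * Mᴴ = C := by
    calc M * S * Mᴴ = (M * M⁻¹) * C * ((M⁻¹)ᴴ * Mᴴ) := by rw [hSdef]; simp only [Matrix.mul_assoc]
      _ = C := by rw [hMM, hMM']; simp
  have hA : W * Wᴴ = M * (P⁻¹ + S) * Mᴴ := by
    rw [Matrix.mul_add, Matrix.add_mul, hCS, hCdef]; abel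
  have hx : (P⁻¹ + S).det * P.det = (1 + Kᴴ * (S * K)).det := by
    rw [← Matrix.det_mul, Matrix.add_mul, Matrix.nonsing_inv_mul _ hPu, hPdef, ← Matrix.mul_assoc,
      Matrix.det_one_add_mul_comm]
  have h1 : 1 ≤ (P⁻¹ + S).det * P.det := by
    rw [hx]
    apply aux_one_le_det
    rw [← Matrix.mul_assoc]
    exact hS.conjTranspose_mul_mul_same K
  have hstar : star P.det = P.det := by
    rw [← Matrix.det_conjTranspose, hP.1.eq]
  rw [hA, Matrix.det_mul, Matrix.det_mul, Matrix.det_conjTranspose, hM, hstar, mul_assoc]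
  exact le_mul_of_one_le_right hd.le h1

theorem aux_posDef_s2 {n : ℕ} (ρ : ℝ) (hρ : 0 ≤ ρ) (A : Matrix (Fin n) (Fin n) ℂ) :
    (snrMat ρ A).PosDef := by
  unfold snrMat
  refine Matrix.PosDef.one.add_posSemidef ?_
  refine (Matrix.posSemidef_self_mul_conjTranspose A).smul ?_
  exact_mod_cast hρ

theorem aux_cols {n : ℕ} (ρ : ℝ) (hρ : 0 ≤ ρ) (A B : Matrix (Fin n) (Fin n) ℂ) :
    Matrix.fromCols (1 : Matrix (Fin n) (Fin n) ℂ) (((√ρ : ℝ) : ℂ) • A) * (Matrix.fromCols (1 : Matrix (Fin n) (Fin n) ℂ) (((√ρ : ℝ) : ℂ) • B))ᴴ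
      = 1 + (ρ : ℂ) • (A * Bᴴ) := by
  rw [Matrix.conjTranspose_fromCols_eq_fromRows_conjTranspose, Matrix.fromCols_mul_fromRows,
    Matrix.conjTranspose_smul]
  simp [smul_smul, ← Complex.ofReal_mul, Real.mul_self_sqrt hρ]

theorem aux_main_s2 {n : ℕ} (ρ : ℝ) (hρ : 0 ≤ ρ) (A B : Matrix (Fin n) (Fin n) ℂ)
    (h : (1 + (ρ : ℂ) • (A * Bᴴ)).det = (snrMat ρ B).det) :
    (snrMat ρ B).det ≤ (snrMat ρ A).det := by
  have hB := aux_posDef_s2 ρ hρ B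
  unfold snrMat at *
  have := aux_gram (Matrix.fromCols (1 : Matrix (Fin n) (Fin n) ℂ) (((√ρ : ℝ) : ℂ) • A)) (Matrix.fromCols (1 : Matrix (Fin n) (Fin n) ℂ) (((√ρ : ℝ) : ℂ) • B))
  simp only [aux_cols ρ hρ] at this
  exact this hB h

theorem aux_block {n : ℕ} {α : Type*} [LinearOrder α] (b : Fin n → α)
    (ρ : ℝ) (A B : Matrix (Fin n) (Fin n) ℂ)
    (h1 : ∀ i j, b j < b i → (A * Bᴴ) i j = 0)
    (h2 : ∀ i j, b j ≤ b i → (A * Bᴴ) i j = (B * Bᴴ) i j) :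
    (1 + (ρ : ℂ) • (A * Bᴴ)).det = (snrMat ρ B).det := by
  unfold snrMat
  have t1 : (1 + (ρ : ℂ) • (A * Bᴴ)).BlockTriangular b := by
    intro i j hij
    have : i ≠ j := by rintro rfl; exact lt_irrefl _ hij
    simp [Matrix.one_apply, this, h1 i j hij]
  have t2 : (1 + (ρ : ℂ) • (B * Bᴴ)).BlockTriangular b := by
    intro i j hij
    have : i ≠ j := by rintro rfl; exact lt_irrefl _ hij
    simp [Matrix.one_apply, this, h1 i j hij, ← h2 i j hij.le]
  rw [t1.det, t2.det]
  refine Finset.prod_congr rfl fun k _ => ?_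
  congr 1
  ext ⟨i, hi⟩ ⟨j, hj⟩
  simp [Matrix.toSquareBlock_def, h2 i j (hj.trans hi.symm).le]

/-- For a block upper triangular matrix `H` (with respect to a monotone block
labeling `b`), with block-diagonal part `H_d` and `ℓ`-th super-diagonal part
`H_ℓ` (where the `ℓ`-th super-diagonal is the last possibly nonzero one),
one has `det(I + ρ·H·Hᴴ) ≥ det(I + ρ·H_d·H_dᴴ)` and
`det(I + ρ·H·Hᴴ) ≥ det(I + ρ·H_ℓ·H_ℓᴴ)`, all three determinants being
positive reals. -/
theorem stmt_2 {n N : ℕ} (hn : 0 < n) (hN : 0 < N)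
    (b : Fin n → Fin N) (hb : Monotone b)
    (ρ : ℝ) (hρ : 0 ≤ ρ) (ℓ : ℕ) (hℓ : 1 ≤ ℓ)
    (H Hd Hl : Matrix (Fin n) (Fin n) ℂ)
    (hH : ∀ i j, b i > b j → H i j = 0)
    (hHsup : ∀ i j, (b j : ℕ) - (b i : ℕ) > ℓ → H i j = 0)
    (hHd : ∀ i j, Hd i j = if b i = b j then H i j else 0)
    (hHl : ∀ i j, Hl i j = if (b j : ℕ) = (b i : ℕ) + ℓ then H i j else 0) :
    ((snrMat ρ H).det).im = 0 ∧ 0 < ((snrMat ρ H).det).re ∧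
    ((snrMat ρ Hd).det).im = 0 ∧ 0 < ((snrMat ρ Hd).det).re ∧
    ((snrMat ρ Hl).det).im = 0 ∧ 0 < ((snrMat ρ Hl).det).re ∧
    ((snrMat ρ Hd).det).re ≤ ((snrMat ρ H).det).re ∧
    ((snrMat ρ Hl).det).re ≤ ((snrMat ρ H).det).re := by
  have pH := (aux_posDef_s2 ρ hρ H).det_pos
  have pd := (aux_posDef_s2 ρ hρ Hd).det_pos
  have pl := (aux_posDef_s2 ρ hρ Hl).det_pos
  have kd : (snrMat ρ Hd).det ≤ (snrMat ρ H).det := by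
    apply aux_main_s2 ρ hρ
    apply aux_block b
    · intro i j hij
      rw [Matrix.mul_apply]
      refine Finset.sum_eq_zero fun k _ => ?_
      rw [Matrix.conjTranspose_apply, hHd]
      by_cases h : b j = b k
      · rw [hH i k (h ▸ hij), zero_mul]
      · simp [h]
    · intro i j hij
      rw [Matrix.mul_apply, Matrix.mul_apply]
      refine Finset.sum_congr rfl fun k _ => ?_
      rw [Matrix.conjTranspose_apply, hHd j k, hHd i k]
      by_cases h : b j = b k
      · rcases hij.eq_or_lt with h' | h'
        · simp [← h', h]
        · rw [hH i k (h ▸ h')]; simp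
      · simp [h]
  have kl : (snrMat ρ Hl).det ≤ (snrMat ρ H).det := by
    apply aux_main_s2 ρ hρ
    apply aux_block (fun i => OrderDual.toDual (b i))
    · intro i j hij
      have hij' : (b i : ℕ) < (b j : ℕ) := hij
      rw [Matrix.mul_apply]
      refine Finset.sum_eq_zero fun k _ => ?_
      rw [Matrix.conjTranspose_apply, hHl]
      by_cases h : (b k : ℕ) = (b j : ℕ) + ℓ
      · rw [hHsup i k (by omega), zero_mul]
      · simp [h]
    · intro i j hij
      have hij' : (b i : ℕ) ≤ (b j : ℕ) := hij
      rw [Matrix.mul_apply, Matrix.mul_apply]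
      refine Finset.sum_congr rfl fun k _ => ?_
      rw [Matrix.conjTranspose_apply, hHl j k, hHl i k]
      by_cases h : (b k : ℕ) = (b j : ℕ) + ℓ
      · rcases hij'.eq_or_lt with h' | h'
        · simp [h', h]
        · rw [hHsup i k (by omega)]; simp
      · simp [h]
  rw [Complex.lt_def] at pH pd pl
  exact ⟨pH.2.symm, pH.1, pd.2.symm, pd.1, pl.2.symm, pl.1, kd.1, kl.1⟩
end

section
/- Let A and B be n×n Hermitian positive definite complex matrices, let λ_min(B) and λ_max(B) denote the smallest and largest eigenvalues of B, and let ρ ≥ 0 be a real number. Then the determinant det(I + ρ·A·B) is a positive real number and satisfies det(I + ρ·λ_min(B)·A) ≤ det(I + ρ·A·B) ≤ det(I + ρ·λ_max(B)·A). -/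
open Matrix ComplexOrder

lemma aux_decomp {n : ℕ} {B : Matrix (Fin n) (Fin n) ℂ} (hB : B.IsHermitian) :
    ∃ U : Matrix (Fin n) (Fin n) ℂ, U * Uᴴ = 1 ∧
      B = U * diagonal (fun i => (hB.eigenvalues i : ℂ)) * Uᴴ := by
  refine ⟨hB.eigenvectorUnitary, ?_, ?_⟩
  · exact Unitary.coe_mul_star_self hB.eigenvectorUnitary
  · have := hB.spectral_theorem
    rw [Unitary.conjStarAlgAut_apply] at this
    exact this

lemma aux_one_le {n : ℕ} {R : Matrix (Fin n) (Fin n) ℂ} (hR : R.PosSemidef) :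
    1 ≤ (1 + R).det := by
  obtain ⟨U, hU, hE⟩ := aux_decomp hR.1
  have h1 : 1 + R = U * diagonal (fun i => ((1 + hR.1.eigenvalues i : ℝ) : ℂ)) * Uᴴ := by
    have : diagonal (fun i => ((1 + hR.1.eigenvalues i : ℝ) : ℂ))
      = 1 + diagonal (fun i => (hR.1.eigenvalues i : ℂ)) := by
      rw [← diagonal_one, diagonal_add]; simp
    rw [this, Matrix.mul_add, Matrix.add_mul, Matrix.mul_one, hU, ← hE]
  have h2 : U.det * Uᴴ.det = 1 := by rw [← det_mul, hU, det_one]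
  rw [h1, det_mul, det_mul, mul_right_comm, h2, one_mul, det_diagonal, ← Complex.ofReal_prod]
  have : (1 : ℝ) ≤ ∏ i, (1 + hR.1.eigenvalues i) := by
    calc (1 : ℝ) = ∏ i : Fin n, (1 : ℝ) := by simp
      _ ≤ _ := Finset.prod_le_prod (fun i _ => zero_le_one)
        (fun i _ => by linarith [hR.eigenvalues_nonneg i])
  exact_mod_cast this

open scoped MatrixOrder Matrix.Norms.L2Operator in
lemma aux_fac {n : ℕ} {Q : Matrix (Fin n) (Fin n) ℂ} (hQ : Q.PosSemidef) :
    ∃ D : Matrix (Fin n) (Fin n) ℂ, Q = Dᴴ * D :=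
  CStarAlgebra.nonneg_iff_eq_star_mul_self.mp hQ.nonneg

lemma aux_mono {n : ℕ} {P Q : Matrix (Fin n) (Fin n) ℂ} (hP : P.PosDef)
    (hQ : (Q - P).PosSemidef) : P.det ≤ Q.det := by
  obtain ⟨D, hD⟩ := aux_fac hQ
  have hu : IsUnit P.det := hP.det_pos.ne'.isUnit
  have h1 : Q = P * (1 + (P⁻¹ * Dᴴ) * D) := by
    rw [Matrix.mul_add, Matrix.mul_assoc, Matrix.mul_nonsing_inv_cancel_left _ _ hu, ← hD]
    simp
  have h2 : 1 ≤ (1 + (P⁻¹ * Dᴴ) * D).det := by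
    rw [det_one_add_mul_comm, ← Matrix.mul_assoc]
    exact aux_one_le (hP.inv.posSemidef.mul_mul_conjTranspose_same D)
  rw [h1, det_mul]
  exact le_mul_of_one_le_right hP.det_pos.le h2

lemma aux_psd {n : ℕ} {B : Matrix (Fin n) (Fin n) ℂ} (hB : B.IsHermitian) (s c : ℝ)
    (h : ∀ i, 0 ≤ s * hB.eigenvalues i + c) : ((s : ℂ) • B + (c : ℂ) • 1).PosSemidef := by
  obtain ⟨U, hU, hE⟩ := aux_decomp hB
  have h1 : (s : ℂ) • B + (c : ℂ) • 1
      = U * diagonal (fun i => ((s * hB.eigenvalues i + c : ℝ) : ℂ)) * Uᴴ := by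
    have : diagonal (fun i => ((s * hB.eigenvalues i + c : ℝ) : ℂ))
      = (s : ℂ) • diagonal (fun i => (hB.eigenvalues i : ℂ)) + (c : ℂ) • 1 := by
      rw [← diagonal_one, ← diagonal_smul, ← diagonal_smul, diagonal_add]; simp
    rw [this, Matrix.mul_add, Matrix.add_mul, Matrix.mul_smul, Matrix.smul_mul, ← hE,
      Matrix.mul_smul, Matrix.smul_mul, Matrix.mul_one, hU]
  rw [h1]
  apply PosSemidef.mul_mul_conjTranspose_same
  apply PosSemidef.diagonal
  intro i
  simpa using (by exact_mod_cast h i : (0 : ℂ) ≤ ((s * hB.eigenvalues i + c : ℝ) : ℂ))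



/-- Amir-Moez type determinant bounds: for Hermitian positive definite `A, B`
with smallest and largest eigenvalues `lmin, lmax` of `B`, and `ρ ≥ 0`,
the determinant `det(I + ρ·A·B)` is a positive real number and
`det(I + ρ·lmin·A) ≤ det(I + ρ·A·B) ≤ det(I + ρ·lmax·A)`. -/
theorem stmt_3 {n : ℕ} (hn : 0 < n)
    (A B : Matrix (Fin n) (Fin n) ℂ)
    (hA : A.PosDef) (hB : B.PosDef)
    (lmin lmax : ℝ)
    (hmin : IsLeast (Set.range hB.1.eigenvalues) lmin)
    (hmax : IsGreatest (Set.range hB.1.eigenvalues) lmax)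
    (ρ : ℝ) (hρ : 0 ≤ ρ) :
    ((1 + (ρ : ℂ) • (A * B)).det).im = 0 ∧
    0 < ((1 + (ρ : ℂ) • (A * B)).det).re ∧
    ((1 + ((ρ * lmin : ℝ) : ℂ) • A).det).im = 0 ∧
    ((1 + ((ρ * lmax : ℝ) : ℂ) • A).det).im = 0 ∧
    ((1 + ((ρ * lmin : ℝ) : ℂ) • A).det).re ≤ ((1 + (ρ : ℂ) • (A * B)).det).re ∧
    ((1 + (ρ : ℂ) • (A * B)).det).re ≤ ((1 + ((ρ * lmax : ℝ) : ℂ) • A).det).re := by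
  obtain ⟨C, hC⟩ := aux_fac hA.posSemidef
  have key : ∀ X : Matrix (Fin n) (Fin n) ℂ, (1 + A * X).det = (1 + C * X * Cᴴ).det := by
    intro X
    rw [hC, Matrix.mul_assoc, det_one_add_mul_comm]
  have hpd : ∀ X : Matrix (Fin n) (Fin n) ℂ, X.PosSemidef → (1 + C * X * Cᴴ).PosDef :=
    fun X hX => PosDef.one.add_posSemidef (hX.mul_mul_conjTranspose_same C)
  have hmono : ∀ X Y : Matrix (Fin n) (Fin n) ℂ, X.PosSemidef → (Y - X).PosSemidef →
      (1 + A * X).det ≤ (1 + A * Y).det := by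
    intro X Y hX hXY
    rw [key, key]
    apply aux_mono (hpd X hX)
    have := hXY.mul_mul_conjTranspose_same C
    rwa [Matrix.mul_sub, Matrix.sub_mul, ← add_sub_add_left_eq_sub _ _ 1] at this
  have hpos : ∀ X : Matrix (Fin n) (Fin n) ℂ, X.PosSemidef → 0 < (1 + A * X).det := by
    intro X hX
    rw [key]
    exact (hpd X hX).det_pos
  have eB : (ρ : ℂ) • (A * B) = A * ((ρ : ℂ) • B) := by rw [Matrix.mul_smul]
  have eA : ∀ c : ℂ, c • A = A * (c • 1) := by
    intro c
    rw [Matrix.mul_smul, Matrix.mul_one]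
  have pB : ((ρ : ℂ) • B).PosSemidef := by
    have := aux_psd hB.1 ρ 0 (fun i => by
      simpa using mul_nonneg hρ (hB.eigenvalues_pos i).le)
    simpa using this
  have pc : ∀ c : ℝ, 0 ≤ c → ((c : ℂ) • (1 : Matrix (Fin n) (Fin n) ℂ)).PosSemidef := by
    intro c hc
    have := aux_psd hB.1 0 c (fun i => by simpa using hc)
    simpa using this
  have l0 : 0 ≤ ρ * lmin := by
    obtain ⟨i, hi⟩ := hmin.1
    rw [← hi]
    exact mul_nonneg hρ (hB.eigenvalues_pos i).le
  have u0 : 0 ≤ ρ * lmax := by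
    obtain ⟨i, hi⟩ := hmax.1
    rw [← hi]
    exact mul_nonneg hρ (hB.eigenvalues_pos i).le
  have d1 : ((ρ : ℂ) • B - ((ρ * lmin : ℝ) : ℂ) • 1).PosSemidef := by
    have := aux_psd hB.1 ρ (-(ρ * lmin)) (fun i => by
      have := mul_le_mul_of_nonneg_left (hmin.2 ⟨i, rfl⟩) hρ
      linarith)
    rwa [Complex.ofReal_neg, neg_smul, ← sub_eq_add_neg] at this
  have d2 : (((ρ * lmax : ℝ) : ℂ) • 1 - (ρ : ℂ) • B).PosSemidef := by
    have := aux_psd hB.1 (-ρ) (ρ * lmax) (fun i => by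
      have := mul_le_mul_of_nonneg_left (hmax.2 ⟨i, rfl⟩) hρ
      linarith)
    rwa [Complex.ofReal_neg, neg_smul, neg_add_eq_sub] at this
  rw [eB, eA, eA]
  have a1 := Complex.lt_def.mp (hpos _ pB)
  have a2 := Complex.lt_def.mp (hpos _ (pc _ l0))
  have a3 := Complex.lt_def.mp (hpos _ (pc _ u0))
  exact ⟨a1.2.symm, a1.1, a2.2.symm, a3.2.symm,
    (Complex.le_def.mp (hmono _ _ (pc _ l0) d1)).1, (Complex.le_def.mp (hmono _ _ pB d2)).1⟩
end

section
/- Let K ≥ 1 and N ≥ 1 be natural numbers, and for each k ∈ Fin K let M k ≥ 1 be a natural number dividing N and let l k : Fin N → Fin (M k) be a map each of whose fibers has exactly N / (M k) elements. Set N_k := N / (M k) and N_max := max_k N_k. Then for every real r with 0 ≤ r ≤ N, the infimum of Σ_{k} Σ_{j ∈ Fin (M k)} α_{k,j} over all families of reals α_{k,j} ≥ 0 satisfying Σ_{i ∈ Fin N} max(0, 1 − Σ_{k} α_{k, l k i}) ≤ r equals (N − r) / N_max, and it is attained by choosing k₀ with N_{k₀} = N_max, setting α_{k₀, j} = (N −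 r)/N for every j ∈ Fin (M k₀), and all other α_{k,j} = 0. -/
/-- Outage exponent of a parallel channel of `N` sub-channels whose
coefficients are products of `K` hop coefficients: hop `k` has `M k`
coefficients, each appearing in exactly `N / M k` sub-channels (via the
assignment maps `l k`).  For `0 ≤ r ≤ N`, the infimum of
`∑ k, ∑ j, α k j` over nonnegative families `α` with
`∑ i, (1 - ∑ k, α k (l k i))⁺ ≤ r` equals `(N - r) / N_max` where
`N_max = max_k (N / M k)`, attained by setting `α k₀ j = (N - r)/N` for every
`j` at an index `k₀` achieving the maximum, and `0` elsewhere. -/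
theorem stmt_6 (K N : ℕ) (hK : 1 ≤ K) (hN : 1 ≤ N)
    (M : Fin K → ℕ) (hM : ∀ k, 1 ≤ M k) (hdvd : ∀ k, M k ∣ N)
    (l : (k : Fin K) → Fin N → Fin (M k))
    (hl : ∀ k, ∀ j : Fin (M k),
      (Finset.univ.filter (fun i : Fin N => l k i = j)).card = N / M k)
    (Nmax : ℕ) (hNmax : IsGreatest (Set.range (fun k => N / M k)) Nmax)
    (r : ℝ) (hr0 : 0 ≤ r) (hrN : r ≤ N) :
    IsLeast {s : ℝ | ∃ α : (k : Fin K) → Fin (M k) → ℝ,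
        (∀ k j, 0 ≤ α k j) ∧
        (∑ i : Fin N, max 0 (1 - ∑ k, α k (l k i))) ≤ r ∧
        s = ∑ k, ∑ j, α k j}
      (((N : ℝ) - r) / (Nmax : ℝ)) ∧
    ∃ k₀ : Fin K, N / M k₀ = Nmax ∧
      (∀ k : Fin K, ∀ _j : Fin (M k),
        (0 : ℝ) ≤ if k = k₀ then ((N : ℝ) - r) / (N : ℝ) else 0) ∧
      (∑ i : Fin N, max 0
          (1 - ∑ k, if k = k₀ then ((N : ℝ) - r) / (N : ℝ) else 0)) ≤ r ∧
      (∑ k, ∑ _j : Fin (M k), if k = k₀ then ((N : ℝ) - r) / (N : ℝ) else 0)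
        = ((N : ℝ) - r) / (Nmax : ℝ) := by
  have hNR : (0 : ℝ) < N := by exact_mod_cast hN
  obtain ⟨⟨k₀, hk₀⟩, hub⟩ := hNmax
  simp only at hk₀
  have hmul : M k₀ * Nmax = N := by rw [← hk₀]; exact Nat.mul_div_cancel' (hdvd k₀)
  have hmulR : (M k₀ : ℝ) * (Nmax : ℝ) = N := by exact_mod_cast hmul
  have hNmpos : 0 < Nmax := by
    rcases Nat.eq_zero_or_pos Nmax with h | h
    · rw [h] at hmul; omega
    · exact h
  have hNmR : (0 : ℝ) < Nmax := by exact_mod_cast hNmpos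
  have h1 : ∀ k : Fin K, ∀ _j : Fin (M k),
        (0 : ℝ) ≤ if k = k₀ then ((N : ℝ) - r) / (N : ℝ) else 0 := by
    intro k _
    split_ifs
    · exact div_nonneg (by linarith) hNR.le
    · exact le_rfl
  have h2 : (∑ i : Fin N, max 0
          (1 - ∑ k, if k = k₀ then ((N : ℝ) - r) / (N : ℝ) else 0)) ≤ r := by
    have e : (1 : ℝ) - ((N : ℝ) - r) / N = r / N := by field_simp; ring
    rw [Finset.sum_ite_eq' Finset.univ k₀ (fun _ => ((N : ℝ) - r) / (N : ℝ))]
    simp only [Finset.mem_univ, if_true]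
    rw [e, max_eq_right (div_nonneg hr0 hNR.le)]
    simp only [Finset.sum_const, Finset.card_univ, Fintype.card_fin, nsmul_eq_mul]
    rw [mul_div_cancel₀ _ hNR.ne']
  have h3 : (∑ k, ∑ _j : Fin (M k), if k = k₀ then ((N : ℝ) - r) / (N : ℝ) else 0)
        = ((N : ℝ) - r) / (Nmax : ℝ) := by
    rw [Finset.sum_eq_single k₀]
    · simp only [if_true, Finset.sum_const, Finset.card_univ, Fintype.card_fin, nsmul_eq_mul]
      rw [mul_div_assoc', div_eq_div_iff hNR.ne' hNmR.ne', ← hmulR]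
      ring
    · intro k _ hk
      simp [hk]
    · simp
  refine ⟨⟨⟨fun k _ => if k = k₀ then ((N : ℝ) - r) / (N : ℝ) else 0, h1, h2, h3.symm⟩, ?_⟩,
    k₀, hk₀, h1, h2, h3⟩
  rintro s ⟨α, hα, hsum, rfl⟩
  rw [div_le_iff₀ hNmR]
  have a1 : ∑ i : Fin N, (1 - ∑ k, α k (l k i)) ≤ r :=
    (Finset.sum_le_sum fun i _ => le_max_right _ _).trans hsum
  rw [Finset.sum_sub_distrib, Finset.sum_comm] at a1
  simp only [Finset.sum_const, Finset.card_univ, Fintype.card_fin, nsmul_eq_mul, mul_one] at a1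
  have a2 : ∑ k, ∑ i : Fin N, α k (l k i) ≤ (∑ k, ∑ j, α k j) * Nmax := by
    rw [Finset.sum_mul]
    refine Finset.sum_le_sum fun k _ => ?_
    rw [← Finset.sum_fiberwise Finset.univ (l k), Finset.sum_mul]
    refine Finset.sum_le_sum fun j _ => ?_
    have : ∑ i ∈ Finset.univ.filter (fun i : Fin N => l k i = j), α k (l k i)
        = ∑ i ∈ Finset.univ.filter (fun i : Fin N => l k i = j), α k j :=
      Finset.sum_congr rfl fun i hi => by rw [(Finset.mem_filter.mp hi).2]
    rw [this, Finset.sum_const, hl, nsmul_eq_mul, mul_comm]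
    refine mul_le_mul_of_nonneg_left ?_ (hα k j)
    exact_mod_cast hub ⟨k, rfl⟩
  linarith
end

section
/- Let m ≥ 1 be a natural number, let n : Fin m → ℕ with n i ≥ 1 for each i, and let r be a real number with 0 ≤ r ≤ m. Then the infimum of Σ_{i ∈ Fin m} Σ_{j ∈ Fin (n i)} u_{i,j} over all families of reals u_{i,j} ≥ 0 satisfying Σ_{i ∈ Fin m} max(0, 1 − Σ_{j ∈ Fin (n i)} u_{i,j}) ≤ r equals m − r, and it is attained by taking, for each i, one variable equal to 1 − r/m and the rest equal to 0. -/
/-- Outage exponent of the edge-disjoint-path relaying scheme: `m` paths,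
path `i` having `n i` edges with SNR exponents `u i j ≥ 0`.  For `0 ≤ r ≤ m`,
the infimum of `∑ i, ∑ j, u i j` over nonnegative families `u` with
`∑ i, (1 - ∑ j, u i j)⁺ ≤ r` equals `m - r`, attained by taking, for each `i`,
one variable equal to `1 - r/m` and the rest equal to `0`. -/
theorem stmt_7 (m : ℕ) (hm : 1 ≤ m) (n : Fin m → ℕ) (hn : ∀ i, 1 ≤ n i)
    (r : ℝ) (hr0 : 0 ≤ r) (hrm : r ≤ m) :
    IsLeast {s : ℝ | ∃ u : (i : Fin m) → Fin (n i) → ℝ,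
        (∀ i j, 0 ≤ u i j) ∧
        (∑ i : Fin m, max 0 (1 - ∑ j, u i j)) ≤ r ∧
        s = ∑ i, ∑ j, u i j}
      ((m : ℝ) - r) ∧
    ∃ u : (i : Fin m) → Fin (n i) → ℝ,
      (∀ i : Fin m, ∃ j₀ : Fin (n i),
        u i j₀ = 1 - r / (m : ℝ) ∧ ∀ j : Fin (n i), j ≠ j₀ → u i j = 0) ∧
      (∀ i j, 0 ≤ u i j) ∧
      (∑ i : Fin m, max 0 (1 - ∑ j, u i j)) ≤ r ∧
      (∑ i, ∑ j, u i j) = (m : ℝ) - r := by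
  have hm0 : (0 : ℝ) < m := by exact_mod_cast hm
  have key : ∃ u : (i : Fin m) → Fin (n i) → ℝ,
      (∀ i : Fin m, ∃ j₀ : Fin (n i),
        u i j₀ = 1 - r / (m : ℝ) ∧ ∀ j : Fin (n i), j ≠ j₀ → u i j = 0) ∧
      (∀ i j, 0 ≤ u i j) ∧
      (∑ i : Fin m, max 0 (1 - ∑ j, u i j)) ≤ r ∧
      (∑ i, ∑ j, u i j) = (m : ℝ) - r := by
    have hq : r / (m : ℝ) ≤ 1 := (div_le_one hm0).2 hrm
    have hq0 : 0 ≤ r / (m : ℝ) := div_nonneg hr0 hm0.le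
    have hs : ∀ i : Fin m, (∑ j : Fin (n i),
        if j = (⟨0, hn i⟩ : Fin (n i)) then 1 - r / (m : ℝ) else 0) = 1 - r / (m : ℝ) := by
      intro i
      rw [Finset.sum_ite_eq' Finset.univ (⟨0, hn i⟩ : Fin (n i))]
      simp
    refine ⟨fun i j => if j = (⟨0, hn i⟩ : Fin (n i)) then 1 - r / (m : ℝ) else 0,
      fun i => ⟨⟨0, hn i⟩, if_pos rfl, fun j hj => if_neg hj⟩, ?_, ?_, ?_⟩
    · intro i j
      dsimp only
      split_ifs
      · linarith
      · exact le_rfl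
    · simp only [hs, sub_sub_cancel, max_eq_right hq0, Finset.sum_const, Finset.card_univ,
        Fintype.card_fin, nsmul_eq_mul]
      exact (mul_div_cancel₀ r hm0.ne').le
    · simp only [hs, Finset.sum_const, Finset.card_univ, Fintype.card_fin, nsmul_eq_mul]
      field_simp
  refine ⟨⟨?_, ?_⟩, key⟩
  · obtain ⟨u, -, h1, h2, h3⟩ := key
    exact ⟨u, h1, h2, h3.symm⟩
  · rintro s ⟨u, h1, h2, rfl⟩
    have h : ∑ i : Fin m, (1 - ∑ j, u i j) ≤ ∑ i : Fin m, max 0 (1 - ∑ j, u i j) :=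
      Finset.sum_le_sum fun i _ => le_max_right _ _
    rw [Finset.sum_sub_distrib] at h
    simp only [Finset.sum_const, Finset.card_univ, Fintype.card_fin, nsmul_eq_mul, mul_one] at h
    linarith
end

section
/- Let K ≥ 4 be a natural number and let n : Fin K → ℕ satisfy n i ≥ 2 for every i. Then there exists a coloring c : (i : Fin K) → Fin (n i) → ZMod K such that: (a) the map i ↦ c i 0 (the colors of the first edges) is injective; (b) the map i ↦ c i (last index of Fin (n i)) (the colors of the last edges) is injective; (c) for every i and every j with j + 1 < n i, c i j ≠ c i (j+1); and (d) for every i and every j with j + 2 < n i, c i j ≠ c i (j+2). -/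
/-- The pattern of length `n`, running from `0` to `1`. -/
def patt (n j : ℕ) : ℕ :=
  if n % 3 = 2 then j % 3
  else if n % 3 = 0 then (if j % 3 = 0 then 0 else 3 - j % 3)
  else if j = 0 then 0 else (if j % 3 = 0 then 1 else j % 3 + 1)

theorem patt_lt (n j : ℕ) : patt n j < 4 := by
  unfold patt; split_ifs <;> omega

theorem patt_zero (n : ℕ) : patt n 0 = 0 := by
  unfold patt; split_ifs <;> omega

theorem patt_last (n : ℕ) (h : 2 ≤ n) : patt n (n - 1) = 1 := by
  unfold patt; split_ifs <;> omega

theorem patt_one (n j : ℕ) : patt n j ≠ patt n (j + 1) := by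
  intro h; unfold patt at h; split_ifs at h <;> omega

theorem patt_two (n j : ℕ) : patt n j ≠ patt n (j + 2) := by
  intro h; unfold patt at h; split_ifs at h <;> omega

theorem zcast_inj (K a b : ℕ) (ha : a < K) (hb : b < K) (h : (a : ZMod K) = b) : a = b := by
  rw [ZMod.natCast_eq_natCast_iff'] at h
  rwa [Nat.mod_eq_of_lt ha, Nat.mod_eq_of_lt hb] at h

/-- Existence of a rate-one orthogonal protocol for KPP networks with `K ≥ 4`
paths: there is an edge coloring `c i j ∈ ZMod K` (of the `j`-th edge of path
`i`) such that the colors of the first edges are distinct across paths, the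
colors of the last edges are distinct across paths, consecutive edges of a
path get distinct colors (half-duplex), and edges at distance two on a path
get distinct colors (no back-flow). -/
theorem stmt_8 (K : ℕ) (hK : 4 ≤ K) (n : Fin K → ℕ) (hn : ∀ i, 2 ≤ n i) :
    ∃ c : (i : Fin K) → Fin (n i) → ZMod K,
      Function.Injective (fun i : Fin K => c i ⟨0, by have := hn i; omega⟩) ∧
      Function.Injective
        (fun i : Fin K => c i ⟨n i - 1, by have := hn i; omega⟩) ∧
      (∀ i : Fin K, ∀ j : ℕ, (hj : j + 1 < n i) →
        c i ⟨j, by omega⟩ ≠ c i ⟨j + 1, hj⟩) ∧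
      (∀ i : Fin K, ∀ j : ℕ, (hj : j + 2 < n i) →
        c i ⟨j, by omega⟩ ≠ c i ⟨j + 2, hj⟩) := by
  refine ⟨fun i j => ((i : ℕ) : ZMod K) + (patt (n i) j : ℕ), ?_, ?_, ?_, ?_⟩
  · intro i i' h
    simp only [patt_zero] at h
    exact Fin.ext (zcast_inj K _ _ i.2 i'.2 (add_right_cancel h))
  · intro i i' h
    simp only [patt_last _ (hn _)] at h
    exact Fin.ext (zcast_inj K _ _ i.2 i'.2 (add_right_cancel h))
  · intro i j hj h
    exact patt_one (n i) j (zcast_inj K _ _ ((patt_lt _ _).trans_le hK)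
      ((patt_lt _ _).trans_le hK) (add_left_cancel h))
  · intro i j hj h
    exact patt_two (n i) j (zcast_inj K _ _ ((patt_lt _ _).trans_le hK)
      ((patt_lt _ _).trans_le hK) (add_left_cancel h))
end

section
/- Let n : Fin 3 → ℕ satisfy n i ≥ 2 for every i, and suppose that the number of indices i with n i ≡ 1 (mod 3) is 0, 1, or 3 (i.e., it is not equal to 2). Then there exists a coloring c : (i : Fin 3) → Fin (n i) → ZMod 3 such that: (a) the map i ↦ c i 0 is a bijection onto ZMod 3; (b) the map i ↦ c i (last index of Fin (n i)) is a bijection onto ZMod 3; (c) for every i and every j with j + 1 < n i, c i j ≠ c i (j+1); and (d) for every i and every j with j + 2 < n i, c i j ≠ c i (j+2). -/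
theorem aux_key : ∀ a b c : Fin 3,
    (Finset.univ.filter (fun i : Fin 3 => ![a, b, c] i = 0)).card ≠ 2 →
    ∃ x y z : Fin 3, (∀ i, ![x, y, z] i ≠ 0) ∧
      Function.Injective (fun i : Fin 3 => i + ![x, y, z] i * ![a, b, c] i) := by
  decide

theorem aux_key2 (m : Fin 3 → ZMod 3)
    (h : (Finset.univ.filter (fun i : Fin 3 => m i = 0)).card ≠ 2) :
    ∃ e : Fin 3 → ZMod 3, (∀ i, e i ≠ 0) ∧
      Function.Injective (fun i : Fin 3 => (show ZMod 3 from i) + e i * m i) := by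
  have hm : m = ![m 0, m 1, m 2] := by
    ext i; fin_cases i <;> rfl
  rw [hm] at h ⊢
  obtain ⟨x, y, z, h1, h2⟩ := aux_key (m 0) (m 1) (m 2) h
  exact ⟨![x, y, z], h1, h2⟩

theorem aux_bij (f : Fin 3 → ZMod 3) (h : Function.Injective f) : Function.Bijective f :=
  (Fintype.bijective_iff_injective_and_card f).2 ⟨h, by simp [ZMod.card]⟩

/-- Existence of a rate-one orthogonal protocol for 3-parallel-path networks:
if the number of paths whose length is `≡ 1 (mod 3)` is not `2`, there is an
edge coloring `c i j ∈ ZMod 3` such that the first-edge colors form a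
bijection onto `ZMod 3`, the last-edge colors form a bijection onto `ZMod 3`,
consecutive edges of a path get distinct colors (half-duplex), and edges at
distance two on a path get distinct colors (no back-flow). -/
theorem stmt_9 (n : Fin 3 → ℕ) (hn : ∀ i, 2 ≤ n i)
    (hcount : (Finset.univ.filter (fun i : Fin 3 => n i % 3 = 1)).card ≠ 2) :
    ∃ c : (i : Fin 3) → Fin (n i) → ZMod 3,
      Function.Bijective (fun i : Fin 3 => c i ⟨0, by have := hn i; omega⟩) ∧
      Function.Bijective
        (fun i : Fin 3 => c i ⟨n i - 1, by have := hn i; omega⟩) ∧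
      (∀ i : Fin 3, ∀ j : ℕ, (hj : j + 1 < n i) →
        c i ⟨j, by omega⟩ ≠ c i ⟨j + 1, hj⟩) ∧
      (∀ i : Fin 3, ∀ j : ℕ, (hj : j + 2 < n i) →
        c i ⟨j, by omega⟩ ≠ c i ⟨j + 2, hj⟩) := by
  have hc : (Finset.univ.filter (fun i : Fin 3 => ((n i - 1 : ℕ) : ZMod 3) = 0)).card ≠ 2 := by
    convert hcount using 4 with i
    rw [ZMod.natCast_eq_zero_iff]
    have := hn i
    omega
  obtain ⟨e, he, hinj⟩ := aux_key2 (fun i => ((n i - 1 : ℕ) : ZMod 3)) hc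
  refine ⟨fun i j => (show ZMod 3 from i) + e i * ((j : ℕ) : ZMod 3), ?_, ?_, ?_, ?_⟩
  · apply aux_bij
    intro i j hij
    simp only [Nat.cast_zero, mul_zero] at hij
    exact add_right_cancel (G := ZMod 3) hij
  · exact aux_bij _ hinj
  · intro i j hj h
    have h1 := add_left_cancel h
    have h2 := he i
    push_cast at h1
    generalize e i = x at *
    generalize (j : ZMod 3) = y at *
    revert x y
    decide
  · intro i j hj h
    have h1 := add_left_cancel h
    have h2 := he i
    push_cast at h1
    generalize e i = x at *
    generalize (j : ZMod 3) = y at *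
    revert x y
    decide
end

section
/- Let n₁ and n₂ be natural numbers with 2 ≤ n₁ ≤ n₂, set n := n₁ + n₂, and let N ≥ 1, m₁, m₂ be natural numbers. Suppose D : ZMod n → Finset (Fin N) satisfies: (i) D j ∩ D (j+1) = ∅ for every j ∈ ZMod n (cyclically adjacent color sets are disjoint); (ii) |D j| = m₁ for every j with (j : ℕ) via ZMod.val less than n₁, and |D j| = m₂ for every j with ZMod.val at least n₁. Then: if n is even, m₁ + m₂ ≤ N; and if n is odd, 2·n₂·(m₁ + m₂) ≤ (2·n₂ − 1)·N. -/
/-- Maximum rate of an orthogonal protocol on a 2-parallel-path network whose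
paths have `n₁ ≤ n₂` edges (each `≥ 2`): labeling the `n = n₁ + n₂` edges of
the resulting cycle by `ZMod n`, a color assignment `D` with cyclically
adjacent edges receiving disjoint color sets, `m₁` colors per edge of path 1
(positions with `val < n₁`) and `m₂` colors per edge of path 2 satisfies
`m₁ + m₂ ≤ N` when `n` is even, and `2·n₂·(m₁ + m₂) ≤ (2·n₂ − 1)·N` when `n`
is odd. -/
theorem stmt_10 (n₁ n₂ : ℕ) (h1 : 2 ≤ n₁) (h12 : n₁ ≤ n₂)
    (N m₁ m₂ : ℕ) (hN : 1 ≤ N)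
    (D : ZMod (n₁ + n₂) → Finset (Fin N))
    (hdisj : ∀ j : ZMod (n₁ + n₂), D j ∩ D (j + 1) = ∅)
    (hcard1 : ∀ j : ZMod (n₁ + n₂), j.val < n₁ → (D j).card = m₁)
    (hcard2 : ∀ j : ZMod (n₁ + n₂), n₁ ≤ j.val → (D j).card = m₂) :
    ((n₁ + n₂) % 2 = 0 → m₁ + m₂ ≤ N) ∧
    ((n₁ + n₂) % 2 = 1 → 2 * n₂ * (m₁ + m₂) ≤ (2 * n₂ - 1) * N) := by
  have hv : ∀ i : ℕ, i < n₁ + n₂ → ((i : ZMod (n₁ + n₂))).val = i :=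
    fun i hi => ZMod.val_natCast_of_lt hi
  have hadj : ∀ j : ZMod (n₁ + n₂), (D j).card + (D (j + 1)).card ≤ N := by
    intro j
    rw [← Finset.card_union_of_disjoint (Finset.disjoint_iff_inter_eq_empty.mpr (hdisj j))]
    simpa using Finset.card_le_univ (D j ∪ D (j + 1))
  have hc1 : ∀ i : ℕ, i < n₁ → (D (i : ZMod (n₁ + n₂))).card = m₁ := fun i hi =>
    hcard1 _ (by rw [hv i (by omega)]; exact hi)
  have hc2 : ∀ i : ℕ, n₁ ≤ i → i < n₁ + n₂ → (D (i : ZMod (n₁ + n₂))).card = m₂ :=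
    fun i hi hi' => hcard2 _ (by rw [hv i hi']; exact hi)
  constructor
  · intro _
    have h := hadj ((n₁ - 1 : ℕ) : ZMod (n₁ + n₂))
    have e : ((n₁ - 1 : ℕ) : ZMod (n₁ + n₂)) + 1 = ((n₁ : ℕ) : ZMod (n₁ + n₂)) := by
      rw [← Nat.cast_add_one]
      congr 1
      omega
    rw [e, hc1 _ (by omega), hc2 _ le_rfl (by omega)] at h
    exact h
  · intro hodd
    have hm : m₁ + m₁ ≤ N := by
      have h := hadj ((0 : ℕ) : ZMod (n₁ + n₂))
      rw [← Nat.cast_add_one, hc1 _ (by omega), hc1 _ (by omega)] at h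
      exact h
    have hcol : ∀ c : Fin N,
        2 * (∑ i ∈ Finset.range (n₁ + n₂),
          if c ∈ D (i : ZMod (n₁ + n₂)) then 1 else 0) + 1 ≤ n₁ + n₂ := by
      intro c
      set x : ℕ → ℕ := fun i => if c ∈ D (i : ZMod (n₁ + n₂)) then 1 else 0 with hx
      have hle : ∑ i ∈ Finset.range (n₁ + n₂), (x i + x (i + 1)) ≤ n₁ + n₂ := by
        calc _ ≤ ∑ i ∈ Finset.range (n₁ + n₂), 1 := by
              apply Finset.sum_le_sum
              intro i _
              have h := hdisj (i : ZMod (n₁ + n₂))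
              have h' : ¬ (c ∈ D (i : ZMod (n₁ + n₂)) ∧ c ∈ D ((i : ZMod (n₁ + n₂)) + 1)) := by
                rw [← Finset.mem_inter, h]
                simp
              simp only [hx, Nat.cast_add, Nat.cast_one]
              split_ifs <;> simp_all
          _ = _ := by simp
      have h0 : x (n₁ + n₂) = x 0 := by
        have : ((n₁ + n₂ : ℕ) : ZMod (n₁ + n₂)) = ((0 : ℕ) : ZMod (n₁ + n₂)) := by
          rw [ZMod.natCast_self, Nat.cast_zero]
        simp only [hx, this]
      have e1 := Finset.sum_range_succ x (n₁ + n₂)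
      have e2 := Finset.sum_range_succ' x (n₁ + n₂)
      rw [Finset.sum_add_distrib] at hle
      change 2 * (∑ i ∈ Finset.range (n₁ + n₂), x i) + 1 ≤ n₁ + n₂
      omega
    have hsum : ∑ i ∈ Finset.range (n₁ + n₂), (D (i : ZMod (n₁ + n₂))).card
        = n₁ * m₁ + n₂ * m₂ := by
      rw [Finset.sum_range_add]
      congr 1
      · rw [Finset.sum_congr rfl (fun i hi => hc1 i (Finset.mem_range.mp hi))]
        simp
      · rw [Finset.sum_congr rfl (fun i hi => hc2 (n₁ + i) (by omega)
          (by have := Finset.mem_range.mp hi; omega))]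
        simp
    have hswap : ∑ i ∈ Finset.range (n₁ + n₂), (D (i : ZMod (n₁ + n₂))).card
        = ∑ c : Fin N, ∑ i ∈ Finset.range (n₁ + n₂),
          (if c ∈ D (i : ZMod (n₁ + n₂)) then 1 else 0) := by
      rw [Finset.sum_comm]
      apply Finset.sum_congr rfl
      intro i _
      simp
    have htot : 2 * (n₁ * m₁ + n₂ * m₂) + N ≤ N * (n₁ + n₂) := by
      have h := Finset.sum_le_sum (fun c (_ : c ∈ (Finset.univ : Finset (Fin N))) => hcol c)
      rw [Finset.sum_add_distrib, ← Finset.mul_sum, ← hswap, hsum] at h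
      simpa using h
    obtain ⟨d, rfl⟩ := Nat.exists_eq_add_of_le h12
    have hd := Nat.mul_le_mul_left d hm
    zify [show 1 ≤ 2 * (n₁ + d) by omega] at *
    nlinarith
end

section
/- Let n₁ and n₂ be natural numbers with 2 ≤ n₁ ≤ n₂ and set n := n₁ + n₂. If n is even, then there exists D : ZMod n → Finset (Fin 2) with D j ∩ D (j+1) = ∅ for all j ∈ ZMod n and |D j| = 1 for all j (achieving rate (1+1)/2 = 1). If n is odd, then there exists D : ZMod n → Finset (Fin (2·n₂)) with D j ∩ D (j+1) = ∅ for all j ∈ ZMod n, |D j| = n₂ for every j whose ZMod.val is less than n₁, and |D j| = n₂ − 1 for every j whose ZMod.val is at least n₁ (achieving rate (n₂ + (n₂−1))/(2n₂) = (2n₂ − 1)/(2n₂)). -/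
def ivl (N l u : ℕ) : Finset (Fin N) := Finset.univ.filter (fun x => l ≤ x.val ∧ x.val < u)

theorem mem_ivl (N l u : ℕ) (x : Fin N) : x ∈ ivl N l u ↔ l ≤ x.val ∧ x.val < u := by
  simp [ivl]

theorem card_ivl (N l u : ℕ) (h : u ≤ N) : (ivl N l u).card = u - l := by
  rw [← Nat.card_Ico, ← Finset.card_map Fin.valEmbedding]
  congr 1
  ext y
  simp only [Finset.mem_map, mem_ivl, Fin.valEmbedding_apply, Finset.mem_Ico]
  constructor
  · rintro ⟨x, hx, rfl⟩
    exact hx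
  · intro hy
    exact ⟨⟨y, by omega⟩, hy, rfl⟩

theorem val_succ (n : ℕ) (hn : 2 ≤ n) (j : ZMod n) :
    j.val < n ∧ ((j.val + 1 < n ∧ (j + 1).val = j.val + 1) ∨ (j.val + 1 = n ∧ (j + 1).val = 0)) := by
  haveI : Fact (1 < n) := ⟨by omega⟩
  haveI : NeZero n := ⟨by omega⟩
  have hlt := ZMod.val_lt j
  have h := ZMod.val_add j 1
  rw [ZMod.val_one] at h
  refine ⟨hlt, ?_⟩
  rcases Nat.lt_or_ge (j.val + 1) n with h2 | h2
  · left
    rw [Nat.mod_eq_of_lt h2] at h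
    exact ⟨h2, h⟩
  · right
    have h3 : j.val + 1 = n := by omega
    rw [h3, Nat.mod_self] at h
    exact ⟨h3, h⟩

def col (a b v : ℕ) : Finset (Fin (2 * b)) :=
  if v < a then (if v % 2 = 0 then ivl (2 * b) 0 b else ivl (2 * b) b (2 * b))
  else if (a + b - 1 - v) % 2 = 0 then
    ivl (2 * b) (b - (a + b - 1 - v)) (2 * b - 1 - (a + b - 1 - v))
  else (ivl (2 * b) (b - 1 - (a + b - 1 - v)) (2 * b - (a + b - 1 - v)))ᶜ

theorem mem_col (a b v : ℕ) (x : Fin (2 * b)) : x ∈ col a b v ↔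
    (v < a ∧ v % 2 = 0 ∧ x.val < b) ∨ (v < a ∧ v % 2 = 1 ∧ b ≤ x.val) ∨
    (a ≤ v ∧ (a + b - 1 - v) % 2 = 0 ∧ b - (a + b - 1 - v) ≤ x.val ∧
      x.val < 2 * b - 1 - (a + b - 1 - v)) ∨
    (a ≤ v ∧ (a + b - 1 - v) % 2 = 1 ∧ ¬ (b - 1 - (a + b - 1 - v) ≤ x.val ∧
      x.val < 2 * b - (a + b - 1 - v))) := by
  have := x.isLt
  unfold col
  split_ifs <;> simp only [mem_ivl, Finset.mem_compl] <;> omega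

/-- Construction of a maximum-rate orthogonal protocol on a 2-parallel-path
network whose paths have `n₁ ≤ n₂` edges (each `≥ 2`), the cycle edges being
labeled by `ZMod (n₁ + n₂)`: if `n₁ + n₂` is even there is a coloring with
cycle length `2` giving each edge one color (rate `1`); if `n₁ + n₂` is odd
there is a coloring with cycle length `2·n₂` giving each edge of path 1
(positions with `val < n₁`) `n₂` colors and each edge of path 2 `n₂ − 1`
colors (rate `(2·n₂ − 1)/(2·n₂)`), with cyclically adjacent edges always
receiving disjoint color sets. -/
theorem stmt_11 (n₁ n₂ : ℕ) (h1 : 2 ≤ n₁) (h12 : n₁ ≤ n₂) :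
    ((n₁ + n₂) % 2 = 0 →
      ∃ D : ZMod (n₁ + n₂) → Finset (Fin 2),
        (∀ j : ZMod (n₁ + n₂), D j ∩ D (j + 1) = ∅) ∧
        (∀ j : ZMod (n₁ + n₂), (D j).card = 1)) ∧
    ((n₁ + n₂) % 2 = 1 →
      ∃ D : ZMod (n₁ + n₂) → Finset (Fin (2 * n₂)),
        (∀ j : ZMod (n₁ + n₂), D j ∩ D (j + 1) = ∅) ∧
        (∀ j : ZMod (n₁ + n₂), j.val < n₁ → (D j).card = n₂) ∧
        (∀ j : ZMod (n₁ + n₂), n₁ ≤ j.val → (D j).card = n₂ - 1)) := by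
  constructor
  · intro he
    refine ⟨fun j => if j.val % 2 = 0 then {0} else {1}, ?_, ?_⟩
    · intro j
      obtain ⟨h0, h⟩ := val_succ (n₁ + n₂) (by omega) j
      dsimp only
      split_ifs
      · omega
      · decide
      · decide
      · omega
    · intro j
      dsimp only
      split_ifs <;> rfl
  · intro ho
    refine ⟨fun j => col n₁ n₂ j.val, ?_, ?_, ?_⟩
    · intro j
      obtain ⟨h0, h⟩ := val_succ (n₁ + n₂) (by omega) j
      rw [Finset.eq_empty_iff_forall_notMem]
      intro x hx
      have hlt := x.isLt
      rw [Finset.mem_inter, mem_col, mem_col] at hx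
      obtain ⟨hx1, hx2⟩ := hx
      generalize (j + 1).val = w at *
      generalize j.val = v at *
      rcases h with ⟨h, rfl⟩ | ⟨h, rfl⟩ <;>
      rcases hx1 with hx1 | hx1 | hx1 | hx1 <;> rcases hx2 with hx2 | hx2 | hx2 | hx2 <;> omega
    · intro j hj
      simp only [col, if_pos hj]
      split_ifs
      · rw [card_ivl _ _ _ (by omega)]; omega
      · rw [card_ivl _ _ _ (by omega)]; omega
    · intro j hj
      obtain ⟨h0, -⟩ := val_succ (n₁ + n₂) (by omega) j
      simp only [col, if_neg (not_lt.mpr hj)]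
      split_ifs
      · rw [card_ivl _ _ _ (by omega)]; omega
      · rw [Finset.card_compl, card_ivl _ _ _ (by omega), Fintype.card_fin]; omega
end

section
/- Let K ≥ 3 be a natural number and let n : Fin K → ℕ be such that the residues are sorted: for all i, j ∈ Fin K, i ≤ j implies (n i) % K ≤ (n j) % K. Then there exists a bijection π : Fin K → ZMod K such that for every i ∈ Fin K, π i ≠ (i : ZMod K) + (n i : ZMod K) − 2 (where i and n i are cast into ZMod K). -/
/-- Existence of a complete matching for protocols with almost continuous
activation on a KPP network with `K ≥ 3` paths: if the path lengths `n i` are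
sorted in ascending order of their residues modulo `K`, then there is a
bijection `π : Fin K → ZMod K` (assigning ending colors to paths) such that
for every path `i`, the ending color `π i` differs from the forbidden color
`i + n i − 2 (mod K)`. -/
theorem stmt_12 (K : ℕ) (hK : 3 ≤ K) (n : Fin K → ℕ)
    (hsorted : ∀ i j : Fin K, i ≤ j → n i % K ≤ n j % K) :
    ∃ π : Fin K → ZMod K, Function.Bijective π ∧
      ∀ i : Fin K, π i ≠ ((i : ℕ) : ZMod K) + (n i : ZMod K) - 2 := by
  haveI : NeZero K := ⟨by omega⟩
  set f : Fin K → ZMod K := fun i => ((i : ℕ) : ZMod K) + (n i : ZMod K) - 2 with hf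
  have hnc : ¬ ∀ i j, f i = f j := by
    intro h
    have key : ∀ i j : Fin K, (j : ℕ) = i + 1 → n j % K = K - 1 ∧ n i % K = 0 := by
      intro i j hij
      have h1 := h i j
      simp only [hf, hij] at h1
      have h2 : ((n i : ℕ) : ZMod K) = ((n j + 1 : ℕ) : ZMod K) := by
        push_cast at h1 ⊢
        linear_combination h1
      rw [ZMod.natCast_eq_natCast_iff'] at h2
      have h3 := hsorted i j (by rw [Fin.le_def]; omega)
      have h4 : n j % K < K := Nat.mod_lt _ (by omega)
      have h5 : (n j + 1) % K = (n j % K + 1) % K := by simp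
      rw [h5] at h2
      by_cases hc : n j % K + 1 < K
      · rw [Nat.mod_eq_of_lt hc] at h2
        omega
      · have : n j % K + 1 = K := by omega
        rw [this, Nat.mod_self] at h2
        omega
    have a := key ⟨0, by omega⟩ ⟨1, by omega⟩ rfl
    have b := key ⟨1, by omega⟩ ⟨2, by omega⟩ rfl
    omega
  have hall := (Finset.all_card_le_biUnion_card_iff_exists_injective
    (fun i : Fin K => (Finset.univ.erase (f i) : Finset (ZMod K)))).1 (by
      intro s
      by_cases hs : ∃ i ∈ s, ∃ j ∈ s, f i ≠ f j
      · obtain ⟨i, hi, j, hj, hij⟩ := hs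
        have : s.biUnion (fun i : Fin K => (Finset.univ.erase (f i) : Finset (ZMod K)))
            = Finset.univ := by
          ext x
          simp only [Finset.mem_biUnion, Finset.mem_erase, Finset.mem_univ, and_true, iff_true]
          by_cases hx : x = f i
          · exact ⟨j, hj, hx ▸ hij⟩
          · exact ⟨i, hi, hx⟩
        rw [this, Finset.card_univ, ZMod.card]
        simpa using Finset.card_le_univ s
      · push Not at hs
        rcases s.eq_empty_or_nonempty with rfl | ⟨i, hi⟩
        · simp
        · have hne : s ≠ Finset.univ := by
            rintro rfl
            exact hnc fun i j => hs i (Finset.mem_univ _) j (Finset.mem_univ _)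
          have h1 : s.card < K := by
            simpa using Finset.card_lt_univ_of_notMem
              (not_forall.1 fun h => hne (Finset.eq_univ_iff_forall.2 h)).choose_spec
          have h2 := Finset.card_le_card (Finset.subset_biUnion_of_mem
            (fun i : Fin K => (Finset.univ.erase (f i) : Finset (ZMod K))) hi)
          rw [Finset.card_erase_of_mem (Finset.mem_univ _), Finset.card_univ, ZMod.card] at h2
          omega)
  obtain ⟨π, hinj, hπ⟩ := hall
  refine ⟨π, (Fintype.bijective_iff_injective_and_card π).2 ⟨hinj, by simp [ZMod.card]⟩, ?_⟩
  intro i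
  exact (Finset.mem_erase.1 (hπ i)).1
end
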